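/- There exist a field K, finite-dimensional K-algebras S and R, a finite-dimensional cotilting S-R-bimodule C for which no S-R-bimodule structure exists on an injective envelope of the left S-module C containing C as a sub-bimodule, together with a (non-hereditary) finite-dimensional K-algebra R*, a surjective K-algebra homomorphism F: R* → R whose kernel is a 2-dimensional K-vector space, and an S-R*-bimodule U containing C (where C is regarded as an S-R*-bimodule by restriction of the right action along F) as a sub-bimodule, such that the underlying left S-module of U is an injective envelope of the left S-module C. -/

import Mathlib

open CategoryTheory

noncomputable section

/-! ### Generalities -/

section Generalities

variable (A : Type) [Ring A]

/-- `Ext^n_A(M, N) = 0`. -/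
def ExtVanish (M N : ModuleCat.{0} A) (n : ℕ) : Prop :=
  Subsingleton (((Ext ℤ (ModuleCat.{0} A) n).obj (Opposite.op M)).obj N)

/-- `N ∈ Prod M`: `N` is a direct summand of a direct product of copies of `M`. -/
def InProd (M N : ModuleCat.{0} A) : Prop :=
  ∃ (ι : Type) (s : N ⟶ ModuleCat.of A (ι → M)) (r : ModuleCat.of A (ι → M) ⟶ N),
    s ≫ r = 𝟙 N

/-- `Q` is an injective cogenerator of the category of left `A`-modules. -/
def IsInjectiveCogenerator (Q : ModuleCat.{0} A) : Prop :=
  Injective Q ∧ ∀ X : ModuleCat.{0} A, ∃ (ι : Type) (f : X ⟶ ModuleCat.of A (ι → Q)),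
    Function.Injective f

/-- `C` is a classical cotilting left `A`-module: (i) `C` has injective dimension at most `1`;
(ii) `Ext¹(C^I, C) = 0` for every direct product of copies of `C`; (iii) there is a short
exact sequence `0 → C' → C'' → Q → 0` with `Q` an injective cogenerator and
`C', C'' ∈ Prod C`. -/
def IsClassicalCotilting (C : Type) [AddCommGroup C] [Module A C] : Prop :=
  (∀ (X : ModuleCat.{0} A) (i : ℕ), 1 < i → ExtVanish A X (ModuleCat.of A C) i) ∧
  (∀ ι : Type, ExtVanish A (ModuleCat.of A (ι → C)) (ModuleCat.of A C) 1) ∧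
  (∃ (Q C' C'' : ModuleCat.{0} A) (f : C' ⟶ C'') (g : C'' ⟶ Q),
    IsInjectiveCogenerator A Q ∧ InProd A (ModuleCat.of A C) C' ∧
    InProd A (ModuleCat.of A C) C'' ∧
    Function.Injective f ∧ Function.Surjective g ∧ Function.Exact f g)

/-- `E`, together with the embedding `j`, is an injective envelope of `C`:
`E` is injective, `j` is injective, and the image of `j` is essential in `E`. -/
def IsInjEnvelope (C E : Type) [AddCommGroup C] [Module A C]
    [AddCommGroup E] [Module A E] (j : C →ₗ[A] E) : Prop :=
  Module.Injective A E ∧ Function.Injective j ∧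
    ∀ N : Submodule A E, N ≠ ⊥ → N ⊓ LinearMap.range j ≠ ⊥

variable (B : Type) [Ring B]

/-- an `A`-linear endomorphism commuting with a second (commuting) `B`-action, i.e. an
endomorphism of bimodules. -/
def CommutesWith (M : Type) [AddCommGroup M] [Module A M] [Module B M]
    (p : M →ₗ[A] M) : Prop :=
  ∀ (b : B) (x : M), p (b • x) = b • p x

/-- a bimodule (with commuting `A`- and `B`-actions) is indecomposable iff it is nonzero and
its only idempotent bimodule endomorphisms are `0` and the identity. -/
def BimodIndecomposable (M : Type) [AddCommGroup M] [Module A M] [Module B M] : Prop :=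
  Nontrivial M ∧ ∀ p : M →ₗ[A] M, CommutesWith A B M p → p ∘ₗ p = p →
    p = 0 ∨ p = LinearMap.id

/-- a bimodule is a direct sum of two nonzero sub-bimodules iff it admits a nontrivial
idempotent bimodule endomorphism. -/
def BimodDecomposable (M : Type) [AddCommGroup M] [Module A M] [Module B M] : Prop :=
  ∃ p : M →ₗ[A] M, CommutesWith A B M p ∧ p ∘ₗ p = p ∧ p ≠ 0 ∧ p ≠ LinearMap.id

end Generalities

/-- `C`, an `S`-`R`-bimodule over a field `K` (both algebras and the bimodule being
finite-dimensional over `K`), is a cotilting bimodule: it is faithfully balanced and is a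
classical cotilting module on both sides. -/
def IsCotiltingBimodule (K S R C : Type) [Field K] [Ring S] [Algebra K S] [Ring R]
    [Algebra K R] [AddCommGroup C] [Module S C] [Module Rᵐᵒᵖ C] [SMulCommClass S Rᵐᵒᵖ C] :
    Prop :=
  haveI : SMulCommClass Rᵐᵒᵖ S C := SMulCommClass.symm S Rᵐᵒᵖ C
  Function.Bijective (Module.toModuleEnd Rᵐᵒᵖ C : S →+* Module.End Rᵐᵒᵖ C) ∧
  Function.Bijective (Module.toModuleEnd S C : Rᵐᵒᵖ →+* Module.End S C) ∧
  IsClassicalCotilting S C ∧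
  IsClassicalCotilting Rᵐᵒᵖ C

/-- The left `S`-module `E`, containing the `S`-`R`-bimodule `C` via `j`, admits a right
`R`-module structure making it an `S`-`R`-bimodule containing `C` as a sub-bimodule. -/
def HasRightExtension (S R : Type) [Ring S] [Ring R] (C E : Type) [AddCommGroup C]
    [Module S C] [Module Rᵐᵒᵖ C] [AddCommGroup E] [Module S E] (j : C →ₗ[S] E) : Prop :=
  ∃ m : Module Rᵐᵒᵖ E,
    (by letI := m; exact
      (∀ (s : S) (r : Rᵐᵒᵖ) (x : E), s • r • x = r • s • x) ∧
      (∀ (r : Rᵐᵒᵖ) (c : C), j (r • c) = r • j c) : Prop)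

/-- A ring is left hereditary if every left ideal is projective. -/
def IsLeftHereditary (A : Type) [Ring A] : Prop :=
  ∀ I : Ideal A, Module.Projective A I

/-! ### Statement 15: the bad case repaired by a non-hereditary concealed ring `R*` -/

/-- The data asserted to exist in Statement 15. -/
structure NonHereditaryConcealedExample where
  K : Type
  [fK : Field K]
  S : Type
  [rS : Ring S]
  [aS : Algebra K S]
  finS : FiniteDimensional K S
  R : Type
  [rR : Ring R]
  [aR : Algebra K R]
  finR : FiniteDimensional K R
  C : Type
  [abC : AddCommGroup C]
  [mSC : Module S C]
  [mRC : Module Rᵐᵒᵖ C]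
  [sccC : SMulCommClass S Rᵐᵒᵖ C]
  [mKC : Module K C]
  [towSC : IsScalarTower K S C]
  [towRC : IsScalarTower K Rᵐᵒᵖ C]
  finC : FiniteDimensional K C
  cotilting : IsCotiltingBimodule K S R C
  /-- there is NO bimodule `D ⊇ C` whose underlying left `S`-module is an injective
  envelope of the left `S`-module `C` -/
  noLeftExt : ∀ (E : Type) [AddCommGroup E] [Module S E] (j : C →ₗ[S] E),
    IsInjEnvelope S C E j → ¬ HasRightExtension S R C E j
  -- the concealed ring `R*` and the epimorphism `F : R* → R`
  Rstar : Type
  [rRstar : Ring Rstar]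
  [aRstar : Algebra K Rstar]
  finRstar : FiniteDimensional K Rstar
  F : Rstar →ₐ[K] R
  surjF : Function.Surjective F
  nonhered : ¬ IsLeftHereditary Rstar
  kerF_dim : Module.finrank K ((RingHom.ker (F : Rstar →+* R)).restrictScalars K) = 2
  -- the `S`-`R*`-bimodule `U`, whose underlying left `S`-module is an injective envelope
  -- of `C`, containing `C` (with its right `R*`-action restricted along `F`)
  U : Type
  [abU : AddCommGroup U]
  [mSU : Module S U]
  [mRstarU : Module Rstarᵐᵒᵖ U]
  [sccU : SMulCommClass S Rstarᵐᵒᵖ U]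
  j : C →ₗ[S] U
  envU : IsInjEnvelope S C U j
  j_right_linear : ∀ (r : Rstar) (c : C),
    j (MulOpposite.op (F r) • c) = MulOpposite.op r • j c

theorem subsingleton_Ext_succ {k : Type*} [Ring k] {D : Type*} [Category* D] [Abelian D]
    [Linear k D] [EnoughProjectives D] {X Y : D} (P : ProjectiveResolution X) (n : ℕ)
    (h : ∀ f : P.complex.X (n + 1) ⟶ Y, P.complex.d (n + 2) (n + 1) ≫ f = 0 →
      ∃ g : P.complex.X n ⟶ Y, P.complex.d (n + 1) n ≫ g = f) :
    Subsingleton (((Ext k D (n + 1)).obj (Opposite.op X)).obj Y) := by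
  apply ModuleCat.subsingleton_of_isZero
  refine Limits.IsZero.of_iso ?_ (P.isoExt (n + 1) Y)
  rw [← HomologicalComplex.exactAt_iff_isZero_homology,
    HomologicalComplex.exactAt_iff' _ n (n + 1) (n + 2) (by simp) (by simp),
    ShortComplex.moduleCat_exact_iff]
  intro f hf
  exact h f hf

theorem exists_factor {D : Type*} [Category* D] [Abelian D]
    {E : ShortComplex D} (hE : E.ShortExact) [Injective E.X₂]
    {P₂ P₁ P₀ : D} {d₂ : P₂ ⟶ P₁} {d₁ : P₁ ⟶ P₀} (w : d₂ ≫ d₁ = 0)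
    (hP : (ShortComplex.mk d₂ d₁ w).Exact)
    (hlift : ∀ g : P₀ ⟶ E.X₃, d₁ ≫ g = 0 → ∃ g' : P₀ ⟶ E.X₂, d₁ ≫ g' = 0 ∧ g' ≫ E.g = g)
    (f : P₁ ⟶ E.X₁) (hf : d₂ ≫ f = 0) : ∃ g : P₀ ⟶ E.X₁, d₁ ≫ g = f := by
  have := hE.mono_f
  have h₁ : d₁ ≫ hP.descToInjective (f ≫ E.f) (by simp [reassoc_of% hf]) = f ≫ E.f :=
    hP.comp_descToInjective _ _
  set g := hP.descToInjective (f ≫ E.f) (by simp [reassoc_of% hf])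
  obtain ⟨g', hg', hg'E⟩ := hlift (g ≫ E.g) (by simp [reassoc_of% h₁])
  obtain ⟨l, hl⟩ := hE.exact.lift' (g - g') (by simp [hg'E])
  refine ⟨l, ?_⟩
  rw [← cancel_mono E.f, Category.assoc, hl, Preadditive.comp_sub, h₁, hg', sub_zero]

theorem subsingleton_Ext_add_two {k : Type*} [Ring k] {D : Type*} [Category* D] [Abelian D]
    [Linear k D] [EnoughProjectives D] (X : D) {E : ShortComplex D} (hE : E.ShortExact)
    [Injective E.X₂]
    [Injective E.X₃] (n : ℕ) :
    Subsingleton (((Ext k D (n + 2)).obj (Opposite.op X)).obj E.X₁) := by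
  have := hE.epi_g
  let P := ProjectiveResolution.of X
  refine subsingleton_Ext_succ P (n + 1)
    (exists_factor hE _ (P.exact_succ (n + 1)) fun g hg => ?_)
  have h := (P.exact_succ n).comp_descToInjective g hg
  refine ⟨P.complex.d (n + 1) n ≫
    Projective.factorThru ((P.exact_succ n).descToInjective g hg) E.g, by simp, ?_⟩
  rw [Category.assoc, Projective.factorThru_comp]
  exact h

theorem subsingleton_Ext_one {k : Type*} [Ring k] {D : Type*} [Category* D] [Abelian D]
    [Linear k D] [EnoughProjectives D] {X : D} {E : ShortComplex D} (hE : E.ShortExact)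
    [Injective E.X₂]
    (hX : ∀ g : X ⟶ E.X₃, ∃ g' : X ⟶ E.X₂, g' ≫ E.g = g) :
    Subsingleton (((Ext k D 1).obj (Opposite.op X)).obj E.X₁) := by
  let P := ProjectiveResolution.of X
  refine subsingleton_Ext_succ P 0
    (exists_factor hE _ (P.exact_succ 0) fun g hg => ?_)
  obtain ⟨p, hp, hpg⟩ : ∃ (p : P.complex.X 0 ⟶ X), P.complex.d 1 0 ≫ p = 0 ∧
      ∃ h : X ⟶ E.X₃, p ≫ h = g :=
    ⟨P.π.f 0, P.complex_d_comp_π_f_zero, P.exact₀.desc g hg, P.exact₀.g_desc _ _⟩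
  obtain ⟨h, rfl⟩ := hpg
  obtain ⟨g', rfl⟩ := hX h
  exact ⟨p ≫ g', by rw [← Category.assoc]; exact (congrArg (· ≫ g') hp).trans Limits.zero_comp,
    Category.assoc _ _ _⟩

/-- The algebra of the lower triangular matrices `!![p, 0, 0; b, q, 0; x, c, p]`, that is, the path
algebra of the quiver with two opposite arrows `b` and `c` modulo the relation `bc = 0`, where
`x = cb`. -/
@[ext] structure Aus (K : Type) where
  (p q b c x : K)

namespace Aus

variable {K : Type} [Field K]

instance : Zero (Aus K) := ⟨⟨0, 0, 0, 0, 0⟩⟩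
instance : One (Aus K) := ⟨⟨1, 1, 0, 0, 0⟩⟩
instance : Add (Aus K) := ⟨fun s t => ⟨s.p + t.p, s.q + t.q, s.b + t.b, s.c + t.c, s.x + t.x⟩⟩
instance : Neg (Aus K) := ⟨fun s => ⟨-s.p, -s.q, -s.b, -s.c, -s.x⟩⟩
instance : SMul K (Aus K) := ⟨fun k s => ⟨k * s.p, k * s.q, k * s.b, k * s.c, k * s.x⟩⟩
instance : Mul (Aus K) := ⟨fun s t => ⟨s.p * t.p, s.q * t.q, s.b * t.p + s.q * t.b,
  s.c * t.q + s.p * t.c, s.x * t.p + s.c * t.b + s.p * t.x⟩⟩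

theorem zero_def : (0 : Aus K) = ⟨0, 0, 0, 0, 0⟩ := rfl
theorem one_def : (1 : Aus K) = ⟨1, 1, 0, 0, 0⟩ := rfl
theorem add_def (s t : Aus K) :
    s + t = ⟨s.p + t.p, s.q + t.q, s.b + t.b, s.c + t.c, s.x + t.x⟩ := rfl
theorem smul_def (k : K) (s : Aus K) :
    k • s = ⟨k * s.p, k * s.q, k * s.b, k * s.c, k * s.x⟩ := rfl
theorem mul_def (s t : Aus K) : s * t = ⟨s.p * t.p, s.q * t.q, s.b * t.p + s.q * t.b,
  s.c * t.q + s.p * t.c, s.x * t.p + s.c * t.b + s.p * t.x⟩ := rfl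

instance : Ring (Aus K) where
  nsmul := nsmulRec
  zsmul := zsmulRec
  add_assoc _ _ _ := by ext <;> exact add_assoc _ _ _
  zero_add _ := by ext <;> exact zero_add _
  add_zero _ := by ext <;> exact add_zero _
  add_comm _ _ := by ext <;> exact add_comm _ _
  neg_add_cancel _ := by ext <;> exact neg_add_cancel _
  left_distrib _ _ _ := by ext <;> simp only [add_def, mul_def] <;> ring
  right_distrib _ _ _ := by ext <;> simp only [add_def, mul_def] <;> ring
  zero_mul _ := by ext <;> simp [zero_def, mul_def]
  mul_zero _ := by ext <;> simp [zero_def, mul_def]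
  one_mul _ := by ext <;> simp [one_def, mul_def]
  mul_one _ := by ext <;> simp [one_def, mul_def]
  mul_assoc _ _ _ := by ext <;> simp only [mul_def] <;> ring

instance : Module K (Aus K) where
  one_smul _ := by ext <;> exact one_mul _
  mul_smul _ _ _ := by ext <;> exact mul_assoc _ _ _
  smul_zero _ := by ext <;> exact mul_zero _
  zero_smul _ := by ext <;> exact zero_mul _
  smul_add _ _ _ := by ext <;> exact mul_add _ _ _
  add_smul _ _ _ := by ext <;> exact add_mul _ _ _

instance : Algebra K (Aus K) := Algebra.ofModule
  (fun _ _ _ => by ext <;> simp only [smul_def, mul_def] <;> ring)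
  (fun _ _ _ => by ext <;> simp only [smul_def, mul_def] <;> ring)

instance : FiniteDimensional K (Aus K) :=
  FiniteDimensional.of_injective
    ({ toFun := fun s => ![s.p, s.q, s.b, s.c, s.x]
       map_add' := fun _ _ => by simp [add_def]
       map_smul' := fun _ _ => by simp [smul_def] } : Aus K →ₗ[K] Fin 5 → K)
    fun s t h => by
      ext
      exacts [congrFun h 0, congrFun h 1, congrFun h 2, congrFun h 3, congrFun h 4]

theorem algebraMap_def (k : K) : algebraMap K (Aus K) k = ⟨k, k, 0, 0, 0⟩ := by
  rw [Algebra.algebraMap_eq_smul_one]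
  ext <;> simp [smul_def, one_def]

/-- The anti-automorphism exchanging the two arrows. -/
def flip : (Aus K)ᵐᵒᵖ ≃ₐ[K] Aus K where
  toFun s := ⟨s.unop.p, s.unop.q, s.unop.c, s.unop.b, s.unop.x⟩
  invFun s := .op ⟨s.p, s.q, s.c, s.b, s.x⟩
  left_inv _ := rfl
  right_inv _ := rfl
  map_mul' _ _ := by ext <;> simp only [mul_def, MulOpposite.unop_mul] <;> ring
  map_add' _ _ := rfl
  commutes' _ := by simp [algebraMap_def]

theorem flip_op (s : Aus K) : flip (.op s) = ⟨s.p, s.q, s.c, s.b, s.x⟩ := rfl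

end Aus

section Representations

variable {K A B : Type} [Field K] [Ring A] [Algebra K A] [Ring B] [Algebra K B] {n : ℕ}

/-- The space of column vectors on which `A` acts through `ρ`. -/
def ColRep (_ : A →ₐ[K] Matrix (Fin n) (Fin n) K) : Type :=
  Fin n → K

namespace ColRep

variable (ρ : A →ₐ[K] Matrix (Fin n) (Fin n) K)

instance : AddCommGroup (ColRep ρ) := inferInstanceAs (AddCommGroup (Fin n → K))
instance : Module K (ColRep ρ) := inferInstanceAs (Module K (Fin n → K))

instance : Module A (ColRep ρ) where
  smul a v := (ρ a).mulVec v
  one_smul v := (congrArg (Matrix.mulVec · v) (map_one ρ)).trans (Matrix.one_mulVec v)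
  mul_smul a b v :=
    (congrArg (Matrix.mulVec · v) (map_mul ρ a b)).trans (Matrix.mulVec_mulVec v _ _).symm
  smul_zero a := Matrix.mulVec_zero (ρ a)
  smul_add a v w := Matrix.mulVec_add (ρ a) v w
  add_smul a b v := (congrArg (Matrix.mulVec · v) (map_add ρ a b)).trans (Matrix.add_mulVec _ _ v)
  zero_smul v := (congrArg (Matrix.mulVec · v) (map_zero ρ)).trans (Matrix.zero_mulVec v)

instance : IsScalarTower K A (ColRep ρ) where
  smul_assoc k a v :=
    (congrArg (Matrix.mulVec · v) (map_smul ρ k a)).trans (Matrix.smul_mulVec k (ρ a) v)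

variable {ρ}

theorem smul_apply (a : A) (v : ColRep ρ) (i : Fin n) : (a • v) i = ∑ j, ρ a i j * v j := rfl

/-- The vector with the given coordinates. -/
def mk (v : Fin n → K) : ColRep ρ := v

@[simp] theorem mk_apply (v : Fin n → K) (i : Fin n) : (mk v : ColRep ρ) i = v i := rfl
@[simp] theorem add_apply (v w : ColRep ρ) (i : Fin n) : (v + w) i = v i + w i := rfl
@[simp] theorem zero_apply (i : Fin n) : (0 : ColRep ρ) i = 0 := rfl

@[ext] theorem ext {v w : ColRep ρ} (h : ∀ i, v i = w i) : v = w := funext h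

end ColRep

/-- The space of column vectors on which `A` acts through `ρ` and `B` acts through `σ`. -/
def BiRep (_ : A →ₐ[K] Matrix (Fin n) (Fin n) K)
    (_ : B →ₐ[K] Matrix (Fin n) (Fin n) K) : Type :=
  Fin n → K

namespace BiRep

variable (ρ : A →ₐ[K] Matrix (Fin n) (Fin n) K) (σ : B →ₐ[K] Matrix (Fin n) (Fin n) K)

instance : AddCommGroup (BiRep ρ σ) := inferInstanceAs (AddCommGroup (Fin n → K))
instance : Module K (BiRep ρ σ) := inferInstanceAs (Module K (Fin n → K))
instance : FiniteDimensional K (BiRep ρ σ) := inferInstanceAs (FiniteDimensional K (Fin n → K))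
instance : Module A (BiRep ρ σ) := inferInstanceAs (Module A (ColRep ρ))
instance : Module B (BiRep ρ σ) := inferInstanceAs (Module B (ColRep σ))
instance : IsScalarTower K A (BiRep ρ σ) := inferInstanceAs (IsScalarTower K A (ColRep ρ))
instance : IsScalarTower K B (BiRep ρ σ) := inferInstanceAs (IsScalarTower K B (ColRep σ))

variable {ρ σ}

theorem left_smul_apply (a : A) (v : BiRep ρ σ) (i : Fin n) :
    (a • v) i = ∑ j, ρ a i j * v j := rfl
theorem right_smul_apply (b : B) (v : BiRep ρ σ) (i : Fin n) :
    (b • v) i = ∑ j, σ b i j * v j := rfl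

/-- The vector with the given coordinates. -/
def mk (v : Fin n → K) : BiRep ρ σ := v

@[simp] theorem mk_apply (v : Fin n → K) (i : Fin n) : (mk v : BiRep ρ σ) i = v i := rfl
@[simp] theorem add_apply (v w : BiRep ρ σ) (i : Fin n) : (v + w) i = v i + w i := rfl
@[simp] theorem zero_apply (i : Fin n) : (0 : BiRep ρ σ) i = 0 := rfl

@[ext] theorem ext {v w : BiRep ρ σ} (h : ∀ i, v i = w i) : v = w := funext h

end BiRep

end Representations

namespace Aus

variable {K : Type} [Field K]

/-- The indecomposable projective-injective representation. -/
def repV : Aus K →ₐ[K] Matrix (Fin 3) (Fin 3) K :=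
  AlgHom.ofLinearMap
   { toFun := fun s => !![s.p, 0, 0; s.b, s.q, 0; s.x, s.c, s.p]
     map_add' := fun _ _ => by simp [add_def]
     map_smul' := fun _ _ => by simp [smul_def] }
   (by simp [one_def, Matrix.one_fin_three])
   (fun s t => by simp [mul_def]; ring)

/-- The quotient of `repV` by its socle. -/
def repW : Aus K →ₐ[K] Matrix (Fin 2) (Fin 2) K :=
  AlgHom.ofLinearMap
   { toFun := fun s => !![s.p, 0; s.b, s.q]
     map_add' := fun _ _ => by simp [add_def]
     map_smul' := fun _ _ => by simp [smul_def] }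
   (by simp [one_def, Matrix.one_fin_two])
   (fun s t => by simp [mul_def])

/-- The socle of `repV`. -/
def repL : Aus K →ₐ[K] Matrix (Fin 1) (Fin 1) K :=
  AlgHom.ofLinearMap
   { toFun := fun s => !![s.p]
     map_add' := fun _ _ => by simp [add_def]
     map_smul' := fun _ _ => by simp [smul_def] }
   (by ext i j; fin_cases i; fin_cases j; rfl)
   (fun s t => by simp [mul_def])

section

variable {A : Type} [Ring A] [Algebra K A] (e : A ≃ₐ[K] Aus K)

/-- The module given by `repV`. -/
abbrev V := ColRep (repV.comp (e : A →ₐ[K] Aus K))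

/-- The module given by `repW`. -/
abbrev W := ColRep (repW.comp (e : A →ₐ[K] Aus K))

/-- The module given by `repL`. -/
abbrev L := ColRep (repL.comp (e : A →ₐ[K] Aus K))

variable {e}

@[simp] theorem V.smul_zero (a : A) (v : V e) : (a • v) 0 = (e a).p * v 0 := by
  simp [ColRep.smul_apply, Fin.sum_univ_succ, repV]
@[simp] theorem V.smul_one (a : A) (v : V e) : (a • v) 1 = (e a).b * v 0 + (e a).q * v 1 := by
  simp [ColRep.smul_apply, Fin.sum_univ_succ, repV]
@[simp] theorem V.smul_two (a : A) (v : V e) :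
    (a • v) 2 = (e a).x * v 0 + (e a).c * v 1 + (e a).p * v 2 := by
  simp [ColRep.smul_apply, Fin.sum_univ_succ, repV, add_assoc]
@[simp] theorem W.smul_zero (a : A) (v : W e) : (a • v) 0 = (e a).p * v 0 := by
  simp [ColRep.smul_apply, Fin.sum_univ_succ, repW]
@[simp] theorem W.smul_one (a : A) (v : W e) : (a • v) 1 = (e a).b * v 0 + (e a).q * v 1 := by
  simp [ColRep.smul_apply, Fin.sum_univ_succ, repW]
@[simp] theorem L.smul_zero (a : A) (v : L e) : (a • v) 0 = (e a).p * v 0 := by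
  simp [ColRep.smul_apply, repL]

theorem V.smul_eq (a : A) (v : V e) : a • v = ColRep.mk ![(e a).p * v 0,
    (e a).b * v 0 + (e a).q * v 1, (e a).x * v 0 + (e a).c * v 1 + (e a).p * v 2] := by
  ext i
  fin_cases i <;> simp

theorem L.smul_eq (a : A) (v : L e) : a • v = ColRep.mk ![(e a).p * v 0] := by
  ext i
  fin_cases i
  simp

end

end Aus

section Criterion

variable {A : Type} [Ring A]

theorem isInjectiveCogenerator_of {Q : Type} [AddCommGroup Q] [Module A Q]
    (hQ : Module.Injective A Q)
    (h : ∀ (X : Type) [AddCommGroup X] [Module A X] (x : X), (∀ f : X →ₗ[A] Q, f x = 0) → x = 0) :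
    IsInjectiveCogenerator A (ModuleCat.of A Q) := by
  refine ⟨Module.injective_object_of_injective_module A Q, fun X =>
    ⟨X →ₗ[A] Q, ModuleCat.ofHom (LinearMap.pi fun f => f), ?_⟩⟩
  refine (injective_iff_map_eq_zero (LinearMap.pi fun f : X →ₗ[A] Q => f)).2 fun x hx => ?_
  exact h X x fun f => congrFun hx f

variable {C E₀ E₁ : Type} [AddCommGroup C] [Module A C] [AddCommGroup E₀] [Module A E₀]
  [AddCommGroup E₁] [Module A E₁]

theorem isClassicalCotilting_of (i : C →ₗ[A] E₀) (p : E₀ →ₗ[A] E₁) (hi : Function.Injective i)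
    (hp : Function.Surjective p) (hip : Function.Exact i p)
    (hE₀ : Module.Injective A E₀) (hE₁ : Module.Injective A E₁)
    (hlift : ∀ (ι : Type) (f : (ι → C) →ₗ[A] E₁), ∃ g : (ι → C) →ₗ[A] E₀, p ∘ₗ g = f)
    (hseq : ∃ (Q C' C'' : ModuleCat.{0} A) (f : C' ⟶ C'') (g : C'' ⟶ Q),
      IsInjectiveCogenerator A Q ∧ InProd A (ModuleCat.of A C) C' ∧
      InProd A (ModuleCat.of A C) C'' ∧
      Function.Injective f ∧ Function.Surjective g ∧ Function.Exact f g) :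
    IsClassicalCotilting A C := by
  let E : ShortComplex (ModuleCat.{0} A) :=
    ShortComplex.mk (ModuleCat.ofHom i) (ModuleCat.ofHom p)
      (by rw [← ModuleCat.ofHom_comp, hip.linearMap_comp_eq_zero]; rfl)
  have hE : E.ShortExact :=
    { exact := (ShortComplex.ShortExact.moduleCat_exact_iff_function_exact E).2 hip
      mono_f := (ModuleCat.mono_iff_injective _).2 hi
      epi_g := (ModuleCat.epi_iff_surjective _).2 hp }
  have : Injective E.X₂ := Module.injective_object_of_injective_module A E₀
  have : Injective E.X₃ := Module.injective_object_of_injective_module A E₁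
  refine ⟨fun X n hn => ?_, fun ι => ?_, hseq⟩
  · obtain ⟨n, rfl⟩ := Nat.exists_eq_add_of_le' (Nat.succ_le_of_lt hn)
    exact subsingleton_Ext_add_two X hE n
  · refine subsingleton_Ext_one hE fun f => ?_
    obtain ⟨g, hg⟩ := hlift ι f.hom
    exact ⟨ModuleCat.ofHom g, ModuleCat.hom_ext hg⟩

end Criterion

theorem Module.Injective.prod {A M N : Type} [Ring A] [AddCommGroup M] [Module A M]
    [AddCommGroup N] [Module A N] (hM : Module.Injective A M) (hN : Module.Injective A N) :
    Module.Injective A (M × N) where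
  out X Y _ _ _ _ f hf g := by
    obtain ⟨h₁, hh₁⟩ := hM.out f hf (LinearMap.fst A M N ∘ₗ g)
    obtain ⟨h₂, hh₂⟩ := hN.out f hf (LinearMap.snd A M N ∘ₗ g)
    exact ⟨h₁.prod h₂, fun x => Prod.ext (hh₁ x) (hh₂ x)⟩

namespace Aus

variable {K : Type} [Field K] {A : Type} [Ring A] [Algebra K A] (e : A ≃ₐ[K] Aus K)

/-- The inclusion of the socle of `V e`. -/
def soc : L e →ₗ[A] V e where
  toFun l := ColRep.mk ![0, 0, l 0]
  map_add' _ _ := by ext i; fin_cases i <;> simp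
  map_smul' _ _ := by ext i; fin_cases i <;> simp

/-- The projection of `V e` modulo its socle. -/
def quot : V e →ₗ[A] W e where
  toFun v := ColRep.mk ![v 0, v 1]
  map_add' _ _ := by ext i; fin_cases i <;> simp
  map_smul' _ _ := by ext i; fin_cases i <;> simp

theorem soc_injective : Function.Injective (soc e) := fun l m h => by
  ext i
  fin_cases i
  exact congrFun h 2

theorem quot_surjective : Function.Surjective (quot e) := fun w =>
  ⟨ColRep.mk ![w 0, w 1, 0], by ext i; fin_cases i <;> rfl⟩

theorem exact_soc_quot : Function.Exact (soc e) (quot e) := fun v => by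
  constructor
  · intro h
    have h₀ : v 0 = 0 := congrFun h 0
    have h₁ : v 1 = 0 := congrFun h 1
    refine ⟨ColRep.mk ![v 2], ?_⟩
    ext i
    fin_cases i
    exacts [h₀.symm, h₁.symm, rfl]
  · rintro ⟨l, rfl⟩
    ext i
    fin_cases i <;> rfl

section Coinduction

variable {e} {X : Type} [AddCommGroup X] [Module A X]

theorem symm_smul_symm_smul (s t : Aus K) (m : X) :
    e.symm s • e.symm t • m = e.symm (s * t) • m := by
  rw [smul_smul, map_mul]

variable [Module K X] [IsScalarTower K A X]

theorem symm_x_smul_smul (a : A) (m : X) :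
    e.symm ⟨0, 0, 0, 0, 1⟩ • a • m = (e a).p • e.symm ⟨0, 0, 0, 0, 1⟩ • m := by
  rw [smul_smul, ← smul_assoc]
  congr 1
  apply e.injective
  ext <;> simp [mul_def, smul_def]

theorem symm_c_smul_smul (a : A) (m : X) :
    e.symm ⟨0, 0, 0, 1, 0⟩ • a • m =
      (e a).b • e.symm ⟨0, 0, 0, 0, 1⟩ • m + (e a).q • e.symm ⟨0, 0, 0, 1, 0⟩ • m := by
  rw [smul_smul, ← smul_assoc, ← smul_assoc, ← add_smul]
  congr 1
  apply e.injective
  ext <;> simp [mul_def, smul_def, add_def]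

theorem symm_p_smul_smul (a : A) (m : X) :
    e.symm ⟨1, 0, 0, 0, 0⟩ • a • m = (e a).x • e.symm ⟨0, 0, 0, 0, 1⟩ • m +
      (e a).c • e.symm ⟨0, 0, 0, 1, 0⟩ • m + (e a).p • e.symm ⟨1, 0, 0, 0, 0⟩ • m := by
  rw [smul_smul, ← smul_assoc, ← smul_assoc, ← smul_assoc, ← add_smul, ← add_smul]
  congr 1
  apply e.injective
  ext <;> simp [mul_def, smul_def, add_def]

theorem symm_b_smul_smul (a : A) (m : X) :
    e.symm ⟨0, 0, 1, 0, 0⟩ • a • m = (e a).p • e.symm ⟨0, 0, 1, 0, 0⟩ • m := by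
  rw [smul_smul, ← smul_assoc]
  congr 1
  apply e.injective
  ext <;> simp [mul_def, smul_def]

theorem symm_q_smul_smul (a : A) (m : X) :
    e.symm ⟨0, 1, 0, 0, 0⟩ • a • m =
      (e a).b • e.symm ⟨0, 0, 1, 0, 0⟩ • m + (e a).q • e.symm ⟨0, 1, 0, 0, 0⟩ • m := by
  rw [smul_smul, ← smul_assoc, ← smul_assoc, ← add_smul]
  congr 1
  apply e.injective
  ext <;> simp [mul_def, smul_def, add_def]

variable (e)

/-- The `A`-linear map to `V e` whose last coordinate is `φ` on the vertex of the socle. -/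
def coindV (φ : X →ₗ[K] K) : X →ₗ[A] V e where
  toFun m := ColRep.mk ![φ (e.symm ⟨0, 0, 0, 0, 1⟩ • m), φ (e.symm ⟨0, 0, 0, 1, 0⟩ • m),
    φ (e.symm ⟨1, 0, 0, 0, 0⟩ • m)]
  map_add' _ _ := by ext i; fin_cases i <;> simp
  map_smul' a m := by
    ext i
    fin_cases i <;> simp [symm_x_smul_smul, symm_c_smul_smul, symm_p_smul_smul]

/-- The `A`-linear map to `W e` whose last coordinate is `φ` on the vertex of the socle. -/
def coindW (φ : X →ₗ[K] K) : X →ₗ[A] W e where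
  toFun m := ColRep.mk ![φ (e.symm ⟨0, 0, 1, 0, 0⟩ • m), φ (e.symm ⟨0, 1, 0, 0, 0⟩ • m)]
  map_add' _ _ := by ext i; fin_cases i <;> simp
  map_smul' a m := by
    ext i
    fin_cases i <;> simp [symm_b_smul_smul, symm_q_smul_smul]

theorem exists_quot_comp_eq
    (hX : ∀ m : X, e.symm ⟨0, 0, 0, 1, 0⟩ • m = 0 → e.symm ⟨0, 1, 0, 0, 0⟩ • m = 0)
    (f : X →ₗ[A] W e) : ∃ g : X →ₗ[A] V e, quot e ∘ₗ g = f := by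
  have hf (a : A) (m : X) : f (a • m) 1 = (e a).b * f m 0 + (e a).q * f m 1 := by
    rw [map_smul, W.smul_one]
  let ψ : X →ₗ[K] K := LinearMap.proj 1 ∘ₗ f.restrictScalars K
  let c : X →ₗ[K] X := Module.toModuleEnd K X (e.symm ⟨0, 0, 0, 1, 0⟩ : A)
  obtain ⟨φ, hφ⟩ : ψ ∈ LinearMap.range c.dualMap := by
    rw [LinearMap.range_dualMap_eq_dualAnnihilator_ker, Submodule.mem_dualAnnihilator]
    intro m hm
    have h := hf (e.symm ⟨0, 1, 0, 0, 0⟩) m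
    rw [hX m hm] at h
    change f m 1 = 0
    simpa using h.symm
  have hφ' (m : X) : φ (e.symm ⟨0, 0, 0, 1, 0⟩ • m) = f m 1 := LinearMap.congr_fun hφ m
  refine ⟨coindV e φ, LinearMap.ext fun m => ?_⟩
  ext i
  fin_cases i
  · have h := hφ' (e.symm ⟨0, 0, 1, 0, 0⟩ • m)
    rw [symm_smul_symm_smul, hf] at h
    simp only [mul_def, AlgEquiv.apply_symm_apply, zero_mul, mul_zero, one_mul, mul_one,
      zero_add, add_zero] at h
    exact h
  · exact hφ' m

end Coinduction

theorem injective_V : Module.Injective A (V e) := by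
  refine Module.Baer.injective fun I g => ?_
  let φ : I →ₗ[K] K := LinearMap.proj 2 ∘ₗ g.restrictScalars K
  obtain ⟨ψ, hψ⟩ := LinearMap.exists_extend (p := I.restrictScalars K) φ
  have h (s : Aus K) (a : I) : ψ (e.symm s • (a : A)) = (e.symm s • g a) 2 := by
    rw [← map_smul]
    exact LinearMap.congr_fun hψ (e.symm s • a)
  refine ⟨coindV e ψ, fun a ha => ?_⟩
  ext i
  fin_cases i
  · exact (h _ ⟨a, ha⟩).trans (by simp)
  · exact (h _ ⟨a, ha⟩).trans (by simp)
  · exact (h _ ⟨a, ha⟩).trans (by simp)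

theorem injective_W : Module.Injective A (W e) := by
  refine Module.Baer.injective fun I g => ?_
  let φ : I →ₗ[K] K := LinearMap.proj 1 ∘ₗ g.restrictScalars K
  obtain ⟨ψ, hψ⟩ := LinearMap.exists_extend (p := I.restrictScalars K) φ
  have h (s : Aus K) (a : I) : ψ (e.symm s • (a : A)) = (e.symm s • g a) 1 := by
    rw [← map_smul]
    exact LinearMap.congr_fun hψ (e.symm s • a)
  refine ⟨coindW e ψ, fun a ha => ?_⟩
  ext i
  fin_cases i
  · exact (h _ ⟨a, ha⟩).trans (by simp)
  · exact (h _ ⟨a, ha⟩).trans (by simp)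

theorem isInjectiveCogenerator_V_prod_W :
    IsInjectiveCogenerator A (ModuleCat.of A (V e × W e)) := by
  refine isInjectiveCogenerator_of ((injective_V e).prod (injective_W e)) fun X _ _ m hm => ?_
  let := Module.compHom X (algebraMap K A)
  have : IsScalarTower K A X := ⟨fun k a m => by
    rw [Algebra.smul_def, mul_smul]
    rfl⟩
  have hp : e.symm ⟨1, 0, 0, 0, 0⟩ • m = 0 :=
    (Module.forall_dual_apply_eq_zero_iff K _).1 fun φ =>
      congrFun (congrArg Prod.fst (hm ((coindV e φ).prod (coindW e φ)))) 2
  have hq : e.symm ⟨0, 1, 0, 0, 0⟩ • m = 0 :=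
    (Module.forall_dual_apply_eq_zero_iff K _).1 fun φ =>
      congrFun (congrArg Prod.snd (hm ((coindV e φ).prod (coindW e φ)))) 1
  have h1 : (e.symm ⟨1, 0, 0, 0, 0⟩ + e.symm ⟨0, 1, 0, 0, 0⟩ : A) = 1 := by
    rw [← map_add, ← map_one e.symm]
    congr 1
    ext <;> simp [add_def, one_def]
  rw [← one_smul A m, ← h1, add_smul, hp, hq, add_zero]

theorem isClassicalCotilting {C : Type} [AddCommGroup C] [Module A C] [Module K C]
    [IsScalarTower K A C] (φ : C ≃ₗ[A] V e × L e) : IsClassicalCotilting A C := by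
  have hV := injective_V e
  let i : C →ₗ[A] V e × V e := (LinearMap.id.prodMap (soc e)) ∘ₗ φ.toLinearMap
  let p : V e × V e →ₗ[A] W e := quot e ∘ₗ LinearMap.snd A _ _
  have hi : Function.Injective i :=
    (Function.injective_id.prodMap (soc_injective e)).comp φ.injective
  have hp : Function.Surjective p := (quot_surjective e).comp Prod.snd_surjective
  have hip : Function.Exact i p := fun y => by
    refine (exact_soc_quot e y.2).trans ⟨?_, ?_⟩
    · rintro ⟨l, hl⟩
      exact ⟨φ.symm (y.1, l), by simp [i, hl]⟩
    · rintro ⟨m, rfl⟩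
      exact ⟨_, rfl⟩
  refine isClassicalCotilting_of i p hi hp hip (hV.prod hV) (injective_W e) (fun ι f => ?_) ?_
  · have hC (m : ι → C) (hm : e.symm ⟨0, 0, 0, 1, 0⟩ • m = 0) :
        e.symm ⟨0, 1, 0, 0, 0⟩ • m = 0 := by
      ext j
      apply φ.injective
      have h : e.symm ⟨0, 0, 0, 1, 0⟩ • φ (m j) = 0 := by
        rw [← map_smul, ← map_zero φ]
        exact congrArg φ (congrFun hm j)
      have h₁ : (φ (m j)).1 1 = 0 := by
        simpa using congrFun (congrArg Prod.fst h) 2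
      rw [Pi.smul_apply, map_smul, Pi.zero_apply, map_zero]
      refine Prod.ext ?_ ?_
      · ext k
        fin_cases k <;> simp [h₁]
      · ext k
        fin_cases k
        simp
    obtain ⟨g, hg⟩ := exists_quot_comp_eq e hC f
    exact ⟨(0 : _ →ₗ[A] V e).prod g, hg⟩
  · let inc : V e →ₗ[A] C := φ.symm.toLinearMap ∘ₗ LinearMap.inl A _ _
    let pr : C →ₗ[A] V e := LinearMap.fst A _ _ ∘ₗ φ.toLinearMap
    have hpr (v : V e) : pr (inc v) = v := by simp [pr, inc]
    refine ⟨ModuleCat.of A (V e × W e), ModuleCat.of A C, ModuleCat.of A (V e × V e × V e),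
      ModuleCat.ofHom (LinearMap.inr A _ _ ∘ₗ i), ModuleCat.ofHom (LinearMap.id.prodMap p),
      isInjectiveCogenerator_V_prod_W e, ?_, ?_, ?_, ?_, ?_⟩
    · exact ⟨Unit, ModuleCat.ofHom (LinearMap.pi fun _ => LinearMap.id),
        ModuleCat.ofHom (LinearMap.proj ()), rfl⟩
    · refine ⟨Fin 3, ModuleCat.ofHom (LinearMap.pi ![inc ∘ₗ LinearMap.fst A _ _,
        inc ∘ₗ LinearMap.fst A _ _ ∘ₗ LinearMap.snd A _ _,
        inc ∘ₗ LinearMap.snd A _ _ ∘ₗ LinearMap.snd A _ _]),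
        ModuleCat.ofHom ((pr ∘ₗ LinearMap.proj 0).prod
          ((pr ∘ₗ LinearMap.proj 1).prod (pr ∘ₗ LinearMap.proj 2))), ?_⟩
      exact ModuleCat.hom_ext (LinearMap.ext fun y =>
        Prod.ext (hpr _) (Prod.ext (hpr _) (hpr _)))
    · exact fun c d h => hi (congrArg Prod.snd h)
    · exact Function.surjective_id.prodMap hp
    · intro y
      constructor
      · intro h
        obtain ⟨c, hc⟩ := (hip y.2).1 (congrArg Prod.snd h)
        exact ⟨c, Prod.ext (congrArg Prod.fst h).symm hc⟩
      · rintro ⟨c, rfl⟩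
        exact Prod.ext rfl (hip.apply_apply_eq_zero c)

end Aus

/-- The path algebra of the quiver with two opposite arrows `b` and `c` modulo the relation
`cbc = 0`: a basis is formed by the two vertices `p` and `q`, the arrows `b` and `c`, and the paths
`x = cb`, `z = bc` and `y = bcb`. -/
@[ext] structure AusCover (K : Type) where
  (p q b c x y z : K)

namespace AusCover

variable {K : Type} [Field K]

instance : Zero (AusCover K) := ⟨⟨0, 0, 0, 0, 0, 0, 0⟩⟩
instance : One (AusCover K) := ⟨⟨1, 1, 0, 0, 0, 0, 0⟩⟩
instance : Add (AusCover K) := ⟨fun s t =>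
  ⟨s.p + t.p, s.q + t.q, s.b + t.b, s.c + t.c, s.x + t.x, s.y + t.y, s.z + t.z⟩⟩
instance : Neg (AusCover K) := ⟨fun s => ⟨-s.p, -s.q, -s.b, -s.c, -s.x, -s.y, -s.z⟩⟩
instance : SMul K (AusCover K) := ⟨fun k s =>
  ⟨k * s.p, k * s.q, k * s.b, k * s.c, k * s.x, k * s.y, k * s.z⟩⟩
instance : Mul (AusCover K) := ⟨fun s t => ⟨s.p * t.p, s.q * t.q, s.b * t.p + s.q * t.b,
  s.c * t.q + s.p * t.c, s.x * t.p + s.c * t.b + s.p * t.x,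
  s.y * t.p + s.b * t.x + s.z * t.b + s.q * t.y, s.b * t.c + s.z * t.q + s.q * t.z⟩⟩

theorem zero_def : (0 : AusCover K) = ⟨0, 0, 0, 0, 0, 0, 0⟩ := rfl
theorem one_def : (1 : AusCover K) = ⟨1, 1, 0, 0, 0, 0, 0⟩ := rfl
theorem add_def (s t : AusCover K) : s + t =
    ⟨s.p + t.p, s.q + t.q, s.b + t.b, s.c + t.c, s.x + t.x, s.y + t.y, s.z + t.z⟩ := rfl
theorem smul_def (k : K) (s : AusCover K) : k • s =
    ⟨k * s.p, k * s.q, k * s.b, k * s.c, k * s.x, k * s.y, k * s.z⟩ := rfl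
theorem mul_def (s t : AusCover K) : s * t = ⟨s.p * t.p, s.q * t.q, s.b * t.p + s.q * t.b,
  s.c * t.q + s.p * t.c, s.x * t.p + s.c * t.b + s.p * t.x,
  s.y * t.p + s.b * t.x + s.z * t.b + s.q * t.y, s.b * t.c + s.z * t.q + s.q * t.z⟩ := rfl

instance : Ring (AusCover K) where
  nsmul := nsmulRec
  zsmul := zsmulRec
  add_assoc _ _ _ := by ext <;> exact add_assoc _ _ _
  zero_add _ := by ext <;> exact zero_add _
  add_zero _ := by ext <;> exact add_zero _
  add_comm _ _ := by ext <;> exact add_comm _ _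
  neg_add_cancel _ := by ext <;> exact neg_add_cancel _
  left_distrib _ _ _ := by ext <;> simp only [add_def, mul_def] <;> ring
  right_distrib _ _ _ := by ext <;> simp only [add_def, mul_def] <;> ring
  zero_mul _ := by ext <;> simp [zero_def, mul_def]
  mul_zero _ := by ext <;> simp [zero_def, mul_def]
  one_mul _ := by ext <;> simp [one_def, mul_def]
  mul_one _ := by ext <;> simp [one_def, mul_def]
  mul_assoc _ _ _ := by ext <;> simp only [mul_def] <;> ring

instance : Module K (AusCover K) where
  one_smul _ := by ext <;> exact one_mul _
  mul_smul _ _ _ := by ext <;> exact mul_assoc _ _ _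
  smul_zero _ := by ext <;> exact mul_zero _
  zero_smul _ := by ext <;> exact zero_mul _
  smul_add _ _ _ := by ext <;> exact mul_add _ _ _
  add_smul _ _ _ := by ext <;> exact add_mul _ _ _

instance : Algebra K (AusCover K) := Algebra.ofModule
  (fun _ _ _ => by ext <;> simp only [smul_def, mul_def] <;> ring)
  (fun _ _ _ => by ext <;> simp only [smul_def, mul_def] <;> ring)

instance : FiniteDimensional K (AusCover K) :=
  FiniteDimensional.of_injective
    ({ toFun := fun s => ![s.p, s.q, s.b, s.c, s.x, s.y, s.z]
       map_add' := fun _ _ => by simp [add_def]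
       map_smul' := fun _ _ => by simp [smul_def] } : AusCover K →ₗ[K] Fin 7 → K)
    fun s t h => by
      ext
      exacts [congrFun h 0, congrFun h 1, congrFun h 2, congrFun h 3, congrFun h 4, congrFun h 5,
        congrFun h 6]

/-- The projection killing the paths `bc` and `bcb`. -/
def toAus : AusCover K →ₐ[K] Aus K :=
  AlgHom.ofLinearMap
    { toFun := fun s => ⟨s.p, s.q, s.b, s.c, s.x⟩
      map_add' := fun _ _ => rfl
      map_smul' := fun _ _ => rfl }
    rfl (fun _ _ => rfl)

theorem toAus_apply (s : AusCover K) : toAus s = ⟨s.p, s.q, s.b, s.c, s.x⟩ := rfl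

theorem toAus_surjective : Function.Surjective (toAus (K := K)) := fun s =>
  ⟨⟨s.p, s.q, s.b, s.c, s.x, 0, 0⟩, rfl⟩

theorem finrank_ker_toAus : Module.finrank K
    ((RingHom.ker (toAus (K := K) : AusCover K →+* Aus K)).restrictScalars K) = 2 := by
  let f : ((RingHom.ker (toAus (K := K) : AusCover K →+* Aus K)).restrictScalars K) ≃ₗ[K]
      Fin 2 → K :=
    { toFun := fun s => ![s.1.y, s.1.z]
      map_add' := fun _ _ => by simp [add_def]
      map_smul' := fun _ _ => by simp [smul_def]
      invFun := fun v => ⟨⟨0, 0, 0, 0, 0, v 0, v 1⟩, rfl⟩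
      left_inv := fun ⟨s, hs⟩ => by
        have hs' : toAus s = 0 := hs
        ext
        exacts [(congrArg Aus.p hs').symm, (congrArg Aus.q hs').symm, (congrArg Aus.b hs').symm,
          (congrArg Aus.c hs').symm, (congrArg Aus.x hs').symm, rfl, rfl]
      right_inv := fun v => by
        ext i
        fin_cases i <;> rfl }
  rw [f.finrank_eq, Module.finrank_fin_fun]

theorem not_isLeftHereditary : ¬ IsLeftHereditary (AusCover K) := fun h => by
  let m : AusCover K := ⟨0, 0, 0, 0, 1, 0, 0⟩
  let I : Ideal (AusCover K) := Ideal.span {m}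
  have := h I
  let m' : I := ⟨m, Ideal.mem_span_singleton_self m⟩
  have hsurj : Function.Surjective (LinearMap.toSpanSingleton (AusCover K) I m') := by
    rintro ⟨a, ha⟩
    obtain ⟨s, rfl⟩ := Ideal.mem_span_singleton'.1 ha
    exact ⟨s, rfl⟩
  obtain ⟨σ, hσ⟩ := Module.projective_lifting_property _ LinearMap.id hsurj
  have h₁ : σ m' * m = m := congrArg Subtype.val (LinearMap.congr_fun hσ m')
  have h₂ : m * σ m' = 0 := by
    rw [← smul_eq_mul, ← map_smul, ← map_zero σ]
    congr 1
    ext <;> simp [m', m, mul_def, zero_def]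
  have h₃ : (σ m').p = 1 := by simpa [m, mul_def] using congrArg AusCover.x h₁
  have h₄ : (σ m').p = 0 := by simpa [m, mul_def, zero_def] using congrArg AusCover.x h₂
  exact one_ne_zero (h₃.symm.trans h₄)

end AusCover

namespace Aus

variable {K : Type} [Field K]

/-- The direct sum of `repV` (coordinates `0`, `1`, `2`) and `repL` (coordinate `3`). -/
def repC : Aus K →ₐ[K] Matrix (Fin 4) (Fin 4) K :=
  AlgHom.ofLinearMap
    { toFun := fun s => !![s.p, 0, 0, 0; s.b, s.q, 0, 0; s.x, s.c, s.p, 0; 0, 0, 0, s.p]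
      map_add' := fun _ _ => by simp [add_def]
      map_smul' := fun _ _ => by simp [smul_def] }
    (by ext i j; fin_cases i <;> fin_cases j <;> simp [one_def])
    (fun s t => by simp [mul_def]; ring)

/-- The direct sum of `repV` (coordinates `0`, `3`, `2`) and `repL` (coordinate `1`). -/
def repC' : Aus K →ₐ[K] Matrix (Fin 4) (Fin 4) K :=
  AlgHom.ofLinearMap
    { toFun := fun s => !![s.p, 0, 0, 0; 0, s.p, 0, 0; s.x, 0, s.p, s.c; s.b, 0, 0, s.q]
      map_add' := fun _ _ => by simp [add_def]
      map_smul' := fun _ _ => by simp [smul_def] }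
    (by ext i j; fin_cases i <;> fin_cases j <;> simp [one_def])
    (fun s t => by simp [mul_def]; constructor <;> ring)

variable (K) in
/-- A faithfully balanced bimodule which is `V ⊕ L` on both sides, the two copies of `V` sharing
their top and their socle. -/
abbrev C := BiRep (repC (K := K)) (repC'.comp (flip (K := K) : (Aus K)ᵐᵒᵖ →ₐ[K] Aus K))

namespace C

theorem smul_eq (s : Aus K) (m : C K) : s • m = BiRep.mk ![s.p * m 0, s.b * m 0 + s.q * m 1,
    s.x * m 0 + s.c * m 1 + s.p * m 2, s.p * m 3] := by
  ext i
  fin_cases i <;> simp [BiRep.left_smul_apply, Fin.sum_univ_succ, repC, add_assoc]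

theorem op_smul_eq (r : Aus K) (m : C K) : MulOpposite.op r • m = BiRep.mk ![r.p * m 0, r.p * m 1,
    r.x * m 0 + r.b * m 3 + r.p * m 2, r.c * m 0 + r.q * m 3] := by
  ext i
  fin_cases i <;> simp [BiRep.right_smul_apply, Fin.sum_univ_succ, repC', flip_op]
  all_goals ring

instance : SMulCommClass (Aus K) (Aus K)ᵐᵒᵖ (C K) where
  smul_comm s r m := by
    obtain ⟨r, rfl⟩ := MulOpposite.op_surjective r
    ext i
    fin_cases i <;> simp [smul_eq, op_smul_eq] <;> ring

/-- The decomposition of `C` as a left module. -/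
def leftEquiv : C K ≃ₗ[Aus K] V (.refl : Aus K ≃ₐ[K] Aus K) × L (.refl : Aus K ≃ₐ[K] Aus K) where
  toFun m := (ColRep.mk ![m 0, m 1, m 2], ColRep.mk ![m 3])
  invFun y := BiRep.mk ![y.1 0, y.1 1, y.1 2, y.2 0]
  map_add' _ _ := by ext i <;> fin_cases i <;> rfl
  map_smul' s m := by
    rw [smul_eq]
    exact Prod.ext (V.smul_eq (e := .refl) s (.mk ![m 0, m 1, m 2])).symm
      (L.smul_eq (e := .refl) s (.mk ![m 3])).symm
  left_inv _ := by ext i; fin_cases i <;> rfl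
  right_inv _ := by ext i <;> fin_cases i <;> rfl

/-- The decomposition of `C` as a right module. -/
def rightEquiv : C K ≃ₗ[(Aus K)ᵐᵒᵖ] V (flip (K := K)) × L (flip (K := K)) where
  toFun m := (ColRep.mk ![m 0, m 3, m 2], ColRep.mk ![m 1])
  invFun y := BiRep.mk ![y.1 0, y.2 0, y.1 2, y.1 1]
  map_add' _ _ := by ext i <;> fin_cases i <;> rfl
  map_smul' r m := by
    obtain ⟨r, rfl⟩ := MulOpposite.op_surjective r
    rw [op_smul_eq]
    exact Prod.ext (V.smul_eq (e := flip (K := K)) (MulOpposite.op r) (.mk ![m 0, m 3, m 2])).symm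
      (L.smul_eq (e := flip (K := K)) (MulOpposite.op r) (.mk ![m 1])).symm
  left_inv _ := by ext i; fin_cases i <;> rfl
  right_inv _ := by ext i <;> fin_cases i <;> rfl

theorem toModuleEnd_right_bijective :
    haveI := SMulCommClass.symm (Aus K) (Aus K)ᵐᵒᵖ (C K)
    Function.Bijective
      (Module.toModuleEnd (Aus K)ᵐᵒᵖ (C K) : Aus K →+* Module.End (Aus K)ᵐᵒᵖ (C K)) := by
  have := SMulCommClass.symm (Aus K) (Aus K)ᵐᵒᵖ (C K)
  constructor
  · intro s t h
    have h₀ : s • (BiRep.mk ![1, 0, 0, 0] : C K) = t • _ := LinearMap.congr_fun h _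
    have h₁ : s • (BiRep.mk ![0, 1, 0, 0] : C K) = t • _ := LinearMap.congr_fun h _
    rw [smul_eq, smul_eq] at h₀ h₁
    ext
    · simpa using congrFun h₀ 0
    · simpa using congrFun h₁ 1
    · simpa using congrFun h₀ 1
    · simpa using congrFun h₁ 2
    · simpa using congrFun h₀ 2
  · intro f
    let u : C K := BiRep.mk ![1, 0, 0, 0]
    let v : C K := BiRep.mk ![0, 1, 0, 0]
    have hu₃ : f u 3 = 0 := by
      have : MulOpposite.op (⟨1, 0, 0, 0, 0⟩ : Aus K) • u = u := by
        ext i; fin_cases i <;> simp [op_smul_eq, u]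
      rw [← this, map_smul, op_smul_eq]
      simp
    have hv₃ : f v 3 = 0 := by
      have : MulOpposite.op (⟨1, 0, 0, 0, 0⟩ : Aus K) • v = v := by
        ext i; fin_cases i <;> simp [op_smul_eq, v]
      rw [← this, map_smul, op_smul_eq]
      simp
    have hv₀ : f v 0 = 0 := by
      have : MulOpposite.op (⟨0, 0, 0, 0, 1⟩ : Aus K) • v = 0 := by
        ext i; fin_cases i <;> simp [op_smul_eq, v]
      have h := congrFun (congrArg f this) 2
      rw [map_smul, op_smul_eq, map_zero] at h
      simpa using h
    refine ⟨⟨f u 0, f v 1, f u 1, f v 2, f u 2⟩, LinearMap.ext fun m => ?_⟩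
    have hm : m = MulOpposite.op (⟨m 0, 0, 0, m 3, m 2⟩ : Aus K) • u +
        MulOpposite.op (⟨m 1, 0, 0, 0, 0⟩ : Aus K) • v := by
      ext i; fin_cases i <;> simp [op_smul_eq, u, v]
    conv_rhs => rw [hm, map_add, map_smul, map_smul, op_smul_eq, op_smul_eq]
    change (_ : Aus K) • m = _
    rw [smul_eq]
    ext i
    fin_cases i <;> simp [hu₃, hv₃, hv₀] <;> ring

theorem toModuleEnd_left_bijective :
    haveI := SMulCommClass.symm (Aus K) (Aus K)ᵐᵒᵖ (C K)
    Function.Bijective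
      (Module.toModuleEnd (Aus K) (C K) : (Aus K)ᵐᵒᵖ →+* Module.End (Aus K) (C K)) := by
  have := SMulCommClass.symm (Aus K) (Aus K)ᵐᵒᵖ (C K)
  constructor
  · intro s t h
    obtain ⟨s, rfl⟩ := MulOpposite.op_surjective s
    obtain ⟨t, rfl⟩ := MulOpposite.op_surjective t
    have h₀ : MulOpposite.op s • (BiRep.mk ![1, 0, 0, 0] : C K) = MulOpposite.op t • _ :=
      LinearMap.congr_fun h _
    have h₁ : MulOpposite.op s • (BiRep.mk ![0, 0, 0, 1] : C K) = MulOpposite.op t • _ :=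
      LinearMap.congr_fun h _
    rw [op_smul_eq, op_smul_eq] at h₀ h₁
    congr 1
    ext
    · simpa using congrFun h₀ 0
    · simpa using congrFun h₁ 3
    · simpa using congrFun h₁ 2
    · simpa using congrFun h₀ 3
    · simpa using congrFun h₀ 2
  · intro f
    let u : C K := BiRep.mk ![1, 0, 0, 0]
    let t : C K := BiRep.mk ![0, 0, 0, 1]
    have hu₁ : f u 1 = 0 := by
      have : (⟨1, 0, 0, 0, 0⟩ : Aus K) • u = u := by
        ext i; fin_cases i <;> simp [smul_eq, u]
      rw [← this, map_smul, smul_eq]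
      simp
    have ht₁ : f t 1 = 0 := by
      have : (⟨1, 0, 0, 0, 0⟩ : Aus K) • t = t := by
        ext i; fin_cases i <;> simp [smul_eq, t]
      rw [← this, map_smul, smul_eq]
      simp
    have ht₀ : f t 0 = 0 := by
      have : (⟨0, 0, 0, 0, 1⟩ : Aus K) • t = 0 := by
        ext i; fin_cases i <;> simp [smul_eq, t]
      have h := congrFun (congrArg f this) 2
      rw [map_smul, smul_eq, map_zero] at h
      simpa using h
    refine ⟨MulOpposite.op ⟨f u 0, f t 3, f t 2, f u 3, f u 2⟩, LinearMap.ext fun m => ?_⟩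
    have hm : m = (⟨m 0, 0, m 1, 0, m 2⟩ : Aus K) • u + (⟨m 3, 0, 0, 0, 0⟩ : Aus K) • t := by
      ext i; fin_cases i <;> simp [smul_eq, u, t]
    conv_rhs => rw [hm, map_add, map_smul, map_smul, smul_eq, smul_eq]
    change MulOpposite.op (_ : Aus K) • m = _
    rw [op_smul_eq]
    ext i
    fin_cases i <;> simp [hu₁, ht₁, ht₀] <;> ring

theorem isCotiltingBimodule : IsCotiltingBimodule K (Aus K) (Aus K) (C K) :=
  ⟨toModuleEnd_right_bijective, toModuleEnd_left_bijective,
    isClassicalCotilting _ (leftEquiv (K := K)), isClassicalCotilting _ (rightEquiv (K := K))⟩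

section

variable {E : Type} [AddCommGroup E] [Module (Aus K) E] {j : C K →ₗ[Aus K] E}

theorem mem_range_of_smul_eq
    (hj : ∀ N : Submodule (Aus K) E, N ≠ ⊥ → N ⊓ LinearMap.range j ≠ ⊥) {y : E}
    (hy : ∀ s : Aus K, ∃ k : K, s • y = algebraMap K (Aus K) k • y) : y ∈ LinearMap.range j := by
  by_cases h₀ : y = 0
  · exact h₀ ▸ zero_mem _
  obtain ⟨z, ⟨hz, hzj⟩, hz₀⟩ :=
    Submodule.exists_mem_ne_zero_of_ne_bot (hj _ (by simpa using h₀ : Submodule.span _ {y} ≠ ⊥))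
  obtain ⟨s, rfl⟩ := Submodule.mem_span_singleton.1 hz
  obtain ⟨k, hk⟩ := hy s
  rw [hk] at hzj hz₀
  have hk₀ : k ≠ 0 := by rintro rfl; simp at hz₀
  have := Submodule.smul_mem _ (algebraMap K (Aus K) k⁻¹) hzj
  rwa [smul_smul, ← map_mul, inv_mul_cancel₀ hk₀, map_one, one_smul] at this

theorem exists_eq_of_smul_eq (hjinj : Function.Injective j)
    (hj : ∀ N : Submodule (Aus K) E, N ≠ ⊥ → N ⊓ LinearMap.range j ≠ ⊥) {w : E}
    (hp : (⟨1, 0, 0, 0, 0⟩ : Aus K) • w = w) (hx : (⟨0, 0, 0, 0, 1⟩ : Aus K) • w = 0) :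
    ∃ d : C K, j d = w ∧ d 0 = 0 ∧ d 1 = 0 := by
  have hb : (⟨0, 0, 1, 0, 0⟩ : Aus K) • w = 0 := by
    obtain ⟨d, hd⟩ := mem_range_of_smul_eq hj (y := (⟨0, 0, 1, 0, 0⟩ : Aus K) • w) fun s => by
      refine ⟨s.q, ?_⟩
      have : s * ⟨0, 0, 1, 0, 0⟩ = algebraMap K (Aus K) s.q * ⟨0, 0, 1, 0, 0⟩ +
          algebraMap K (Aus K) s.c * ⟨0, 0, 0, 0, 1⟩ := by
        ext <;> simp [mul_def, add_def, algebraMap_def]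
      rw [smul_smul, this, add_smul, mul_smul, mul_smul, hx, smul_zero, add_zero]
    have h₁ : (⟨0, 0, 0, 1, 0⟩ : Aus K) • d = 0 := hjinj <| by
      rw [map_smul, hd, smul_smul, map_zero, ← hx]
      congr 1
      ext <;> simp [mul_def]
    have h₂ : (⟨0, 1, 0, 0, 0⟩ : Aus K) • d = d := hjinj <| by
      rw [map_smul, hd, smul_smul]
      congr 1
      ext <;> simp [mul_def]
    have h₃ : d 1 = 0 := by simpa [smul_eq] using congrFun h₁ 2
    rw [← hd, ← h₂, smul_eq, h₃, ← map_zero j]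
    congr 1
    ext i
    fin_cases i <;> simp
  obtain ⟨d, hd⟩ := mem_range_of_smul_eq hj (y := w) fun s => by
    refine ⟨s.p, ?_⟩
    have : s * ⟨1, 0, 0, 0, 0⟩ = algebraMap K (Aus K) s.p * ⟨1, 0, 0, 0, 0⟩ +
        algebraMap K (Aus K) s.b * ⟨0, 0, 1, 0, 0⟩ +
        algebraMap K (Aus K) s.x * ⟨0, 0, 0, 0, 1⟩ := by
      ext <;> simp [mul_def, add_def, algebraMap_def]
    rw [← hp, smul_smul, this, add_smul, add_smul, mul_smul, mul_smul, mul_smul, hx, hb, smul_zero,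
      smul_zero, add_zero, add_zero]
  have h₁ : (⟨1, 0, 0, 0, 0⟩ : Aus K) • d = d := hjinj (by rw [map_smul, hd, hp])
  have h₂ : (⟨0, 0, 1, 0, 0⟩ : Aus K) • d = 0 := hjinj (by rw [map_smul, hd, hb, map_zero])
  refine ⟨d, hd, by simpa [smul_eq] using congrFun h₂ 1, ?_⟩
  rw [← h₁, smul_eq]
  simp

theorem not_hasRightExtension (h : IsInjEnvelope (Aus K) (C K) E j) :
    ¬ HasRightExtension (Aus K) (Aus K) (C K) E j := by
  obtain ⟨hE, hjinj, hj⟩ := h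
  rintro ⟨m, hcomm, hlin⟩
  let f : L (.refl : Aus K ≃ₐ[K] Aus K) →ₗ[Aus K] E := j ∘ₗ
    { toFun := fun l => BiRep.mk ![0, 0, 0, l 0]
      map_add' := fun _ _ => by ext i; fin_cases i <;> simp
      map_smul' := fun _ _ => by ext i; fin_cases i <;> simp [smul_eq] }
  obtain ⟨g, hg⟩ := hE.out (soc _) (soc_injective _) f
  let u : E := g (ColRep.mk ![1, 0, 0])
  let t : C K := BiRep.mk ![0, 0, 0, 1]
  let b : (Aus K)ᵐᵒᵖ := MulOpposite.op ⟨0, 0, 1, 0, 0⟩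
  let c : (Aus K)ᵐᵒᵖ := MulOpposite.op ⟨0, 0, 0, 1, 0⟩
  have hu : (⟨0, 0, 0, 0, 1⟩ : Aus K) • u = j t := by
    refine (map_smul g _ _).symm.trans (Eq.trans ?_ (hg (ColRep.mk ![1])))
    congr 1
    ext i
    fin_cases i
    · exact (V.smul_zero _ _).trans (zero_mul _)
    · exact (V.smul_one _ _).trans (show (0 : K) * 1 + 0 * 0 = 0 by simp)
    · exact (V.smul_two _ _).trans (show (1 : K) * 1 + 0 * 0 + 0 * 0 = 1 by simp)
  set w : E := (⟨1, 0, 0, 0, 0⟩ : Aus K) • (b • u - j (BiRep.mk ![1, 0, 0, 0])) with hw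
  obtain ⟨d, hd, hd₀, hd₁⟩ := exists_eq_of_smul_eq hjinj hj (w := w)
    (by
      rw [hw, smul_smul]
      congr 1
      ext <;> simp [mul_def])
    (by
      have : (⟨0, 0, 0, 0, 1⟩ : Aus K) * ⟨1, 0, 0, 0, 0⟩ = ⟨0, 0, 0, 0, 1⟩ := by
        ext <;> simp [mul_def]
      rw [hw, smul_smul, this, smul_sub, hcomm, hu, ← hlin, ← map_smul, ← map_sub, ← map_zero j]
      congr 1
      rw [sub_eq_zero]
      ext i
      fin_cases i <;> simp [b, t, smul_eq, op_smul_eq])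
  have hcw : c • w = 0 := by
    rw [← hd, ← hlin, ← map_zero j]
    congr 1
    ext i
    fin_cases i <;> simp [c, op_smul_eq, hd₀, hd₁]
  have hcb : c * b = 0 := by
    rw [← MulOpposite.op_mul, ← MulOpposite.op_zero]
    congr 1
    ext <;> simp [mul_def, zero_def]
  have htw : j t = 0 := by
    rw [hw, ← hcomm, smul_sub, smul_smul, hcb, zero_smul, zero_sub, ← hlin, smul_neg, ← map_smul,
      neg_eq_zero] at hcw
    rw [← hcw]
    congr 1
    ext i
    fin_cases i <;> simp [c, t, smul_eq, op_smul_eq]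
  have ht : t = 0 := hjinj (htw.trans (map_zero j).symm)
  exact one_ne_zero (congrFun ht 3 : (1 : K) = 0)

end

end C

/-- The direct sum of two copies of `repV`. -/
def repU : Aus K →ₐ[K] Matrix (Fin 6) (Fin 6) K :=
  AlgHom.ofLinearMap
    { toFun := fun s => !![s.p, 0, 0, 0, 0, 0; s.b, s.q, 0, 0, 0, 0; s.x, s.c, s.p, 0, 0, 0;
        0, 0, 0, s.p, 0, 0; 0, 0, 0, s.b, s.q, 0; 0, 0, 0, s.x, s.c, s.p]
      map_add' := fun _ _ => by simp [add_def]
      map_smul' := fun _ _ => by simp [smul_def] }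
    (by ext i j; fin_cases i <;> fin_cases j <;> simp [one_def])
    (fun s t => by simp [mul_def]; ring)

/-- A right action of `AusCover K` on two copies of `repV`. -/
def repU' : (AusCover K)ᵐᵒᵖ →ₐ[K] Matrix (Fin 6) (Fin 6) K :=
  AlgHom.ofLinearMap
    { toFun := fun r => !![r.unop.p, 0, 0, r.unop.b, 0, 0; 0, r.unop.p, 0, 0, r.unop.b, 0;
        r.unop.x, 0, r.unop.p, r.unop.y, 0, r.unop.b; 0, 0, 0, r.unop.q, 0, 0;
        0, 0, 0, 0, r.unop.q, 0; r.unop.c, 0, 0, r.unop.z, 0, r.unop.q]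
      map_add' := fun _ _ => by simp [AusCover.add_def]
      map_smul' := fun _ _ => by simp [AusCover.smul_def] }
    (by ext i j; fin_cases i <;> fin_cases j <;> simp [AusCover.one_def])
    (fun s t => by simp [AusCover.mul_def]; ring_nf; simp)

variable (K) in
/-- A left injective envelope of `C`, with a right action of `AusCover K`. -/
abbrev U := BiRep (repU (K := K)) (repU' (K := K))

namespace U

theorem smul_eq (s : Aus K) (m : U K) : s • m = BiRep.mk ![s.p * m 0, s.b * m 0 + s.q * m 1,
    s.x * m 0 + s.c * m 1 + s.p * m 2, s.p * m 3, s.b * m 3 + s.q * m 4,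
    s.x * m 3 + s.c * m 4 + s.p * m 5] := by
  ext i
  fin_cases i <;> simp [BiRep.left_smul_apply, Fin.sum_univ_succ, repU] <;> ring

theorem op_smul_eq (r : AusCover K) (m : U K) : MulOpposite.op r • m =
    BiRep.mk ![r.p * m 0 + r.b * m 3, r.p * m 1 + r.b * m 4,
      r.p * m 2 + r.x * m 0 + r.b * m 5 + r.y * m 3, r.q * m 3, r.q * m 4,
      r.q * m 5 + r.c * m 0 + r.z * m 3] := by
  ext i
  fin_cases i <;> simp [BiRep.right_smul_apply, Fin.sum_univ_succ, repU'] <;> ring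

instance : SMulCommClass (Aus K) (AusCover K)ᵐᵒᵖ (U K) where
  smul_comm s r m := by
    obtain ⟨r, rfl⟩ := MulOpposite.op_surjective r
    ext i
    fin_cases i <;> simp [smul_eq, op_smul_eq] <;> ring

/-- The decomposition of `U` as a left module. -/
def leftEquiv : U K ≃ₗ[Aus K] V (.refl : Aus K ≃ₐ[K] Aus K) × V (.refl : Aus K ≃ₐ[K] Aus K) where
  toFun m := (ColRep.mk ![m 0, m 1, m 2], ColRep.mk ![m 3, m 4, m 5])
  invFun y := BiRep.mk ![y.1 0, y.1 1, y.1 2, y.2 0, y.2 1, y.2 2]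
  map_add' _ _ := by ext i <;> fin_cases i <;> rfl
  map_smul' s m := by
    rw [smul_eq]
    exact Prod.ext (V.smul_eq (e := .refl) s (.mk ![m 0, m 1, m 2])).symm
      (V.smul_eq (e := .refl) s (.mk ![m 3, m 4, m 5])).symm
  left_inv _ := by ext i; fin_cases i <;> rfl
  right_inv _ := by ext i <;> fin_cases i <;> rfl

/-- The embedding of `C` into its left injective envelope. -/
def ofC : C K →ₗ[Aus K] U K where
  toFun m := BiRep.mk ![m 0, m 1, m 2, 0, 0, m 3]
  map_add' _ _ := by ext i; fin_cases i <;> simp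
  map_smul' _ _ := by ext i; fin_cases i <;> simp [smul_eq, C.smul_eq]

theorem ofC_op_smul (r : AusCover K) (m : C K) :
    ofC (MulOpposite.op (AusCover.toAus r) • m) = MulOpposite.op r • ofC m := by
  ext i
  fin_cases i <;> simp [ofC, op_smul_eq, C.op_smul_eq, AusCover.toAus_apply] <;> ring

theorem mem_range_ofC {m : U K} (h₃ : m 3 = 0) (h₄ : m 4 = 0) : m ∈ LinearMap.range ofC :=
  ⟨BiRep.mk ![m 0, m 1, m 2, m 5], by ext i; fin_cases i <;> simp [ofC, h₃, h₄]⟩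

theorem isInjEnvelope_ofC : IsInjEnvelope (Aus K) (C K) (U K) ofC := by
  refine ⟨⟨fun X Y _ _ _ _ f hf g => ?_⟩, fun m n h => ?_, fun N hN => ?_⟩
  · obtain ⟨h, hh⟩ := (Module.Injective.prod (injective_V .refl) (injective_V .refl)).out f hf
      (leftEquiv.toLinearMap ∘ₗ g)
    exact ⟨leftEquiv.symm.toLinearMap ∘ₗ h, fun x => by simp [hh x]⟩
  · ext i
    fin_cases i
    exacts [congrFun h 0, congrFun h 1, congrFun h 2, congrFun h 5]
  · obtain ⟨y, hy, hy₀⟩ := Submodule.exists_mem_ne_zero_of_ne_bot hN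
    suffices h : ∃ s : Aus K, s • y ∈ LinearMap.range ofC ∧ s • y ≠ 0 by
      obtain ⟨s, hs, hs₀⟩ := h
      exact Submodule.ne_bot_iff _ |>.2 ⟨s • y, ⟨N.smul_mem s hy, hs⟩, hs₀⟩
    by_cases h₃ : y 3 = 0
    · by_cases h₄ : y 4 = 0
      · exact ⟨1, by rw [one_smul]; exact mem_range_ofC h₃ h₄, by rwa [one_smul]⟩
      · refine ⟨⟨0, 0, 0, 1, 0⟩, mem_range_ofC (by simp [smul_eq]) (by simp [smul_eq]),
          fun h => h₄ ?_⟩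
        simpa [smul_eq] using congrFun h 5
    · refine ⟨⟨0, 0, 0, 0, 1⟩, mem_range_ofC (by simp [smul_eq]) (by simp [smul_eq]),
          fun h => h₃ ?_⟩
      simpa [smul_eq] using congrFun h 5

end U

end Aus

/-- There exist a finite-dimensional cotilting `S`-`R`-bimodule `C` whose
left injective envelope admits no compatible `S`-`R`-bimodule structure containing `C`,
together with a (non-hereditary) finite-dimensional algebra `R*`, a surjective algebra map
`F : R* → R` with `2`-dimensional kernel, and an `S`-`R*`-bimodule `U` containing `C`
(restricted along `F`) whose underlying left `S`-module is an injective envelope of `C`. -/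
theorem non_hereditary_concealed_ring_exists : Nonempty NonHereditaryConcealedExample :=
  ⟨{  K := ℚ
      S := Aus ℚ
      finS := inferInstance
      R := Aus ℚ
      finR := inferInstance
      C := Aus.C ℚ
      finC := inferInstance
      cotilting := Aus.C.isCotiltingBimodule
      noLeftExt := fun _ _ _ _ h => Aus.C.not_hasRightExtension h
      Rstar := AusCover ℚ
      finRstar := inferInstance
      F := AusCover.toAus
      surjF := AusCover.toAus_surjective
      nonhered := AusCover.not_isLeftHereditary
      kerF_dim := AusCover.finrank_ker_toAus
      U := Aus.U ℚ
      j := Aus.U.ofC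
      envU := Aus.U.isInjEnvelope_ofC
      j_right_linear := Aus.U.ofC_op_smul }⟩
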